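/- arXiv:2605.28278 — 3 statements merged into one kernel-verified Lean document; each statement's English description precedes it below -/
import Mathlib

section
/- Let K be an F-finite field of characteristic p > 0, let A = K[x₁,…,xₙ]/I with I generated by polynomials f_k all of whose coefficients lie in K^p, and let Ã = K[x₁,…,xₙ]/Ĩ with Ĩ generated by the polynomials f̃_k obtained from f_k by replacing each coefficient a by a^{1/p}; let F_K : Ã → A be the ring homomorphism fixing the xᵢ and raising elements of K to the p-th power. Let D : A → A be a K-linear derivation, written D = Σᵢ gᵢ ∂_{xᵢ}. Then D descends to Ã (i.e. there exists a derivation D̃ : Ã → Ã with F_K ∘ D̃ = D ∘ F_K) if and only if there exist g̃ᵢ ∈ Ã such that F_K(g̃ᵢ) = gᵢ for every i; in that case D̃ = Σᵢ g̃ᵢ ∂_{xᵢ}. -/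
/-!
# Statement 4

Explicit description of descent of derivations in local coordinates.  Let
`A = K[x₁,…,xₙ]/I` with `I` generated by a set `s` of polynomials all of whose
coefficients lie in `K^p`, and let `A' = K[x₁,…,xₙ]/I'` where `I'` is generated
by the set `s'` of polynomials obtained by replacing each coefficient by its
`p`-th root (so that `s` is the image of `s'` under coefficient-wise Frobenius).
Let `F : A' →+* A` be the map fixing the variables and raising the coefficients
to the `p`-th power.  A `K`-linear derivation `D = Σᵢ gᵢ ∂_{xᵢ} : A → A` (with
`gᵢ = D xᵢ`) descends to `A'` if and only if each `gᵢ` admits a preimage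
`g'ᵢ ∈ A'` under `F`; in that case the descent is `D' = Σᵢ g'ᵢ ∂_{xᵢ}`, i.e.
`D' xᵢ = g'ᵢ`.
-/

set_option synthInstance.maxHeartbeats 1000000
universe u

/-- The field `K` of characteristic `p > 0` is *F-finite*: the Frobenius
`t ↦ t ^ p` is a finite ring map, i.e. `K ^ p ⊆ K` is a finite field extension. -/
def IsFFinite (K : Type u) [Field K] (p : ℕ) [Fact p.Prime] [CharP K p] : Prop :=
  (frobenius K p).Finite

/-- The structural map `F_K : A' = K[x]/I' →+* A = K[x]/I`, identity on the
variables and `p`-th power on coefficients, realizing `A` as the base change of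
`A'` along the Frobenius of `K`. -/
noncomputable def frobDescentMap (K : Type u) [Field K] (p : ℕ) [Fact p.Prime] [CharP K p]
    (n : ℕ) (s s' : Set (MvPolynomial (Fin n) K))
    (hs : s = MvPolynomial.map (frobenius K p) '' s') :
    (MvPolynomial (Fin n) K ⧸ Ideal.span s') →+* (MvPolynomial (Fin n) K ⧸ Ideal.span s) :=
  Ideal.quotientMap (Ideal.span s) (MvPolynomial.map (frobenius K p))
    (by
      rw [Ideal.span_le]
      intro f hf
      rw [SetLike.mem_coe, Ideal.mem_comap, hs]
      exact Ideal.subset_span ⟨f, hf, rfl⟩)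

attribute [local instance] MvPolynomial.algebraMvPolynomial in
/-- Extending an ideal of polynomials along a field extension and contracting it back
recovers the ideal. -/
theorem MvPolynomial.comap_map_ideal_map_eq_self {σ K L : Type*} [Field K] [Field L]
    (φ : K →+* L) (I : Ideal (MvPolynomial σ K)) :
    (I.map (MvPolynomial.map φ)).comap (MvPolynomial.map φ) = I := by
  let _ : Algebra K L := φ.toAlgebra
  have : Module.Free (MvPolynomial σ K) (MvPolynomial σ L) :=
    Module.Free.of_equiv
      (Algebra.IsPushout.equiv K (MvPolynomial σ K) L (MvPolynomial σ L)).toLinearEquiv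
  exact Ideal.comap_map_eq_self_of_faithfullyFlat (B := MvPolynomial σ L) I

/-- A derivation of `S` restricts along an injective ring homomorphism `F : R →+* S`
as soon as it maps the range of `F` into itself. -/
theorem Derivation.exists_restrict_of_injective {k R S : Type*} [CommRing k] [CommRing R]
    [CommRing S] [Algebra k S] {F : R →+* S} (hF : Function.Injective F) (D : Derivation k S S)
    (h : ∀ x, ∃ y, F y = D (F x)) :
    ∃ D' : Derivation ℤ R R, ∀ x, F (D' x) = D (F x) := by
  choose d hd using h
  let δ : R →+ R :=
    { toFun := d
      map_zero' := hF (by simp [hd])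
      map_add' := fun x y => hF (by simp [hd]) }
  exact ⟨Derivation.mk' δ.toIntLinearMap fun x y => hF (by simp [δ, hd]), hd⟩

section

variable (K : Type u) [Field K] (p : ℕ) [Fact p.Prime] [CharP K p]
  (n : ℕ) (s s' : Set (MvPolynomial (Fin n) K)) (hs : s = MvPolynomial.map (frobenius K p) '' s')

theorem frobDescentMap_mk (f : MvPolynomial (Fin n) K) :
    frobDescentMap K p n s s' hs (Ideal.Quotient.mk _ f) =
      Ideal.Quotient.mk _ (MvPolynomial.map (frobenius K p) f) :=
  Ideal.quotientMap_mk

theorem frobDescentMap_injective : Function.Injective (frobDescentMap K p n s s' hs) := by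
  refine Ideal.quotientMap_injective' ?_
  rw [hs, ← Ideal.map_span, MvPolynomial.comap_map_ideal_map_eq_self]

theorem frobDescentMap_exists_eq_derivation
    (D : Derivation K (MvPolynomial (Fin n) K ⧸ Ideal.span s)
      (MvPolynomial (Fin n) K ⧸ Ideal.span s))
    (h : ∀ i : Fin n, ∃ g' : MvPolynomial (Fin n) K ⧸ Ideal.span s',
      frobDescentMap K p n s s' hs g' =
        D (Ideal.Quotient.mk (Ideal.span s) (MvPolynomial.X i)))
    (x : MvPolynomial (Fin n) K ⧸ Ideal.span s') :
    ∃ y, frobDescentMap K p n s s' hs y = D (frobDescentMap K p n s s' hs x) := by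
  obtain ⟨f, rfl⟩ := Ideal.Quotient.mk_surjective x
  induction f using MvPolynomial.induction_on with
  | C a =>
    refine ⟨0, ?_⟩
    rw [frobDescentMap_mk, MvPolynomial.map_C, map_zero]
    exact (D.map_algebraMap (frobenius K p a)).symm
  | add f g hf hg =>
    obtain ⟨y, hy⟩ := hf
    obtain ⟨z, hz⟩ := hg
    exact ⟨y + z, by simp only [map_add, hy, hz]⟩
  | mul_X f i hf =>
    obtain ⟨y, hy⟩ := hf
    obtain ⟨z, hz⟩ := h i
    refine ⟨Ideal.Quotient.mk _ f * z + Ideal.Quotient.mk _ (MvPolynomial.X i) * y, ?_⟩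
    simp only [map_add, map_mul, Derivation.leibniz, smul_eq_mul, hy, hz, frobDescentMap_mk,
      MvPolynomial.map_X]

end

/-- A `K`-linear derivation `D = Σᵢ gᵢ ∂_{xᵢ}` of `A = K[x₁,…,xₙ]/I`
descends to the model `A' = K[x₁,…,xₙ]/I'` over `K^p` if and only if there are
`g'ᵢ ∈ A'` with `F_K (g'ᵢ) = gᵢ`; in that case the descent is `D' = Σᵢ g'ᵢ ∂_{xᵢ}`. -/
theorem derivation_descends_iff_coefficients_descend
    (K : Type u) [Field K] (p : ℕ) [Fact p.Prime] [CharP K p] (hFF : IsFFinite K p)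
    (n : ℕ) (s s' : Set (MvPolynomial (Fin n) K))
    -- the generators of `I` have all their coefficients in `K^p` …
    (hcoeff : ∀ f ∈ s, ∀ m : Fin n →₀ ℕ, f.coeff m ∈ Set.range (frobenius K p))
    -- … and `s'` is obtained from `s` by taking `p`-th roots of the coefficients:
    (hs : s = MvPolynomial.map (frobenius K p) '' s')
    (D : Derivation K (MvPolynomial (Fin n) K ⧸ Ideal.span s)
      (MvPolynomial (Fin n) K ⧸ Ideal.span s)) :
    -- `D` descends to `A'` iff every `gᵢ = D xᵢ` lifts along `F_K` …
    ((∃ D' : Derivation ℤ (MvPolynomial (Fin n) K ⧸ Ideal.span s')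
          (MvPolynomial (Fin n) K ⧸ Ideal.span s'),
        ∀ x, frobDescentMap K p n s s' hs (D' x) = D (frobDescentMap K p n s s' hs x)) ↔
      (∀ i : Fin n, ∃ g' : MvPolynomial (Fin n) K ⧸ Ideal.span s',
        frobDescentMap K p n s s' hs g' =
          D (Ideal.Quotient.mk (Ideal.span s) (MvPolynomial.X i)))) ∧
    -- … and in that case the descent is `D' = Σᵢ g'ᵢ ∂_{xᵢ}`:
    (∀ D' : Derivation ℤ (MvPolynomial (Fin n) K ⧸ Ideal.span s')
        (MvPolynomial (Fin n) K ⧸ Ideal.span s'),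
      (∀ x, frobDescentMap K p n s s' hs (D' x) = D (frobDescentMap K p n s s' hs x)) →
      ∀ (i : Fin n) (g' : MvPolynomial (Fin n) K ⧸ Ideal.span s'),
        frobDescentMap K p n s s' hs g' =
          D (Ideal.Quotient.mk (Ideal.span s) (MvPolynomial.X i)) →
        D' (Ideal.Quotient.mk (Ideal.span s') (MvPolynomial.X i)) = g') := by
  have hX (i : Fin n) : frobDescentMap K p n s s' hs (Ideal.Quotient.mk _ (MvPolynomial.X i)) =
      Ideal.Quotient.mk _ (MvPolynomial.X i) := by
    rw [frobDescentMap_mk, MvPolynomial.map_X]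
  have hinj := frobDescentMap_injective K p n s s' hs
  refine ⟨⟨fun ⟨D', hD'⟩ i => ⟨_, (hD' _).trans (congrArg D (hX i))⟩, fun h => ?_⟩, ?_⟩
  · exact Derivation.exists_restrict_of_injective hinj D
      (frobDescentMap_exists_eq_derivation K p n s s' hs D h)
  · intro D' hD' i g' hg'
    exact hinj (by rw [hD', hX, hg'])
end

section
/- Let K be an F-finite field of characteristic p > 0, let (X, X̃) be a descent pair (X a K-variety with model X̃ over K^p), and let ℱ ⊂ Θ_{X/K} be a distribution with model ℱ̃ ⊂ Θ_{X̃/K}. Then ℱ is a foliation (respectively, is p-closed) if and only if ℱ̃ is a foliation (respectively, is p-closed). If moreover X is smooth, then ℱ is regular if and only if ℱ̃ is regular. -/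
/-!
# Statement 5

Let `(X, X̃)` be a descent pair over `K^p` and `ℱ ⊆ Θ_{X/K}` a distribution with
model `ℱ' ⊆ Θ_{X̃/K}`.  Then `ℱ` is a foliation (resp. `p`-closed) if and only
if `ℱ'` is, and (for `X` smooth) `ℱ` is regular iff `ℱ'` is.  Formulated on an
affine chart `X = Spec A`, `X̃ = Spec A'` with model map `F : A' →+* A`.
-/

universe u

/-- `F : A' →+* A` exhibits the `K`-algebra `A'` as a *model over `K ^ p`* of the
`K`-algebra `A`:  the map `F` lies over the Frobenius `F_K : K → K` and exhibits `A`,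
together with its `K`-algebra structure, as the base change `A' ⊗_{K, F_K} K` of `A'`
along `F_K`, formulated through the universal property of pushouts of commutative
rings.  Geometrically, `Spec F` is the projection `X = X̃ ×_{F_K} Spec K → X̃`
identifying `Spec A'` as a model `X̃` of `X = Spec A` over `K ^ p`. -/
structure IsFrobeniusModel (K : Type u) [Field K] (p : ℕ) [Fact p.Prime] [CharP K p]
    (A' A : Type u) [CommRing A'] [CommRing A] [Algebra K A'] [Algebra K A]
    (F : A' →+* A) : Prop where
  semilinear : ∀ t : K, F (algebraMap K A' t) = algebraMap K A (t ^ p)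
  isPushout : ∀ (B : Type u) [CommRing B] (g : A' →+* B) (h : K →+* B),
    (∀ t : K, g (algebraMap K A' t) = h (t ^ p)) →
    ∃! ψ : A →+* B, ψ.comp F = g ∧ ψ.comp (algebraMap K A) = h

section Foliations

variable (K : Type u) [Field K] {A : Type u} [CommRing A] [Algebra K A]

/-- A submodule `ℱ ⊆ Θ_{X/K} = Der_K(A, A)` is *saturated* if the quotient
`Θ_{X/K}/ℱ` is torsion-free.  A saturated submodule is a *distribution*. -/
def Distribution.IsSaturated (ℱ : Submodule A (Derivation K A A)) : Prop :=
  ∀ (a : A) (D : Derivation K A A), a ≠ 0 → a • D ∈ ℱ → D ∈ ℱ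

/-- `ℱ` is closed under Lie brackets of derivations. -/
def Distribution.IsLieClosed (ℱ : Submodule A (Derivation K A A)) : Prop :=
  ∀ D₁ ∈ ℱ, ∀ D₂ ∈ ℱ, ⁅D₁, D₂⁆ ∈ ℱ

/-- `ℱ` is *p-closed*: it is closed under `p`-th powers of derivations
(the `p`-fold iterate of a derivation is again a derivation in characteristic `p`). -/
def Distribution.IsPClosed (p : ℕ) (ℱ : Submodule A (Derivation K A A)) : Prop :=
  ∀ D ∈ ℱ, ∃ D' ∈ ℱ, ∀ a : A, D' a = (⇑D)^[p] a

/-- A *foliation* is a saturated subsheaf closed under Lie brackets. -/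
def Distribution.IsFoliation (ℱ : Submodule A (Derivation K A A)) : Prop :=
  Distribution.IsSaturated K ℱ ∧ Distribution.IsLieClosed K ℱ

/-- `ℱ` is *regular*: the quotient `Θ_{X/K}/ℱ` is locally free (projective). -/
def Distribution.IsRegular (ℱ : Submodule A (Derivation K A A)) : Prop :=
  Module.Projective A (Derivation K A A ⧸ ℱ)

/-- The invariant subalgebra `A^ℱ = {a ∈ A | D a = 0 for all D ∈ ℱ}`: the
coordinate ring of the quotient `X/ℱ` of `X = Spec A` by the foliation `ℱ`. -/
def Distribution.fixedSubalgebra (ℱ : Submodule A (Derivation K A A)) : Subalgebra K A where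
  carrier := {a | ∀ D ∈ ℱ, D a = 0}
  add_mem' := by intro a b ha hb D hD; simp [ha D hD, hb D hD]
  mul_mem' := by intro a b ha hb D hD; simp [Derivation.leibniz, ha D hD, hb D hD]
  one_mem' := by intro D hD; simp
  zero_mem' := by intro D hD; simp
  algebraMap_mem' := by intro t D hD; simp

end Foliations

/-- The distribution `ℱ' ⊆ Θ_{X̃/K}` is a *model* of the distribution
`ℱ ⊆ Θ_{X/K}` along the model map `F : A' →+* A`:  every derivation in `ℱ'`
descends a derivation in `ℱ` (i.e. `F ∘ D' = D ∘ F`), and `ℱ` is generated by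
derivations which descend to `ℱ'`; this expresses that the base change of
`ℱ' ⊆ Θ_{X̃/K}` along the Frobenius `F_K` is isomorphic to `ℱ ⊆ Θ_{X/K}`. -/
structure IsDistributionModel (K : Type u) [Field K] {A' A : Type u}
    [CommRing A'] [CommRing A] [Algebra K A'] [Algebra K A] (F : A' →+* A)
    (ℱ' : Submodule A' (Derivation K A' A')) (ℱ : Submodule A (Derivation K A A)) : Prop where
  descends : ∀ D' ∈ ℱ', ∃ D ∈ ℱ, ∀ x : A', F (D' x) = D (F x)
  spans : ℱ ≤ Submodule.span A
    {D : Derivation K A A | ∃ D' ∈ ℱ', ∀ x : A', F (D' x) = D (F x)}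

open scoped TensorProduct

section Pushout

variable {k L A' A : Type u} [Field k] [Field L] [CommRing A'] [CommRing A]
  [Algebra k L] [Algebra k A'] [Algebra L A] [Algebra A' A]

/-- A ring satisfying the universal property of the pushout is the tensor product. -/
theorem exists_algEquiv_tensorProduct_of_isPushout
    (hcomm : ∀ t : k, algebraMap A' A (algebraMap k A' t) = algebraMap L A (algebraMap k L t))
    (huniv : ∀ (B : Type u) [CommRing B] (g : A' →+* B) (h : L →+* B),
      (∀ t : k, g (algebraMap k A' t) = h (algebraMap k L t)) →
      ∃! ψ : A →+* B, ψ.comp (algebraMap A' A) = g ∧ ψ.comp (algebraMap L A) = h) :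
    ∃ e : A' ⊗[k] L ≃ₐ[A'] A, ∀ l : L, e (1 ⊗ₜ l) = algebraMap L A l := by
  let _ : Algebra k A := ((algebraMap A' A).comp (algebraMap k A')).toAlgebra
  have : IsScalarTower k A' A := .of_algebraMap_eq fun _ => rfl
  let j : L →ₐ[k] A := { algebraMap L A with commutes' := fun t => (hcomm t).symm }
  let f : A' ⊗[k] L →ₐ[A'] A :=
    Algebra.TensorProduct.lift (Algebra.ofId A' A) j fun _ _ => Commute.all _ _
  have hf (x : A') (l : L) : f (x ⊗ₜ l) = algebraMap A' A x * algebraMap L A l := rfl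
  obtain ⟨ψ, ⟨hψ₁, hψ₂⟩, -⟩ := huniv (A' ⊗[k] L) Algebra.TensorProduct.includeLeftRingHom
    (Algebra.TensorProduct.includeRight (R := k) (A := A') (B := L)).toRingHom fun t =>
      ((Algebra.TensorProduct.includeRight (R := k) (A := A') (B := L)).commutes t).symm
  have h₁ (x : A') : ψ (algebraMap A' A x) = x ⊗ₜ 1 := RingHom.congr_fun hψ₁ x
  have h₂ (l : L) : ψ (algebraMap L A l) = 1 ⊗ₜ l := RingHom.congr_fun hψ₂ l
  have hfψ : (f : A' ⊗[k] L →+* A).comp ψ = RingHom.id A := by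
    obtain ⟨χ, -, hχ⟩ := huniv A (algebraMap A' A) (algebraMap L A) hcomm
    rw [hχ (RingHom.id A) ⟨rfl, rfl⟩]
    refine hχ _ ⟨?_, ?_⟩ <;> ext x
    · simp [h₁, hf]
    · simp [h₂, hf]
  have hψf (z : A' ⊗[k] L) : ψ (f z) = z := by
    induction z with
    | zero => simp
    | add x y hx hy => simp [hx, hy]
    | tmul x l => simp [hf, h₁, h₂]
  exact ⟨AlgEquiv.ofBijective f ⟨Function.LeftInverse.injective hψf,
    fun a => ⟨ψ a, RingHom.congr_fun hfψ a⟩⟩, fun l => (hf 1 l).trans (by simp)⟩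

theorem Derivation.rTensor_leibniz (D : Derivation k A' A') (z w : A' ⊗[k] L) :
    (D : A' →ₗ[k] A').rTensor L (z * w) =
      z * (D : A' →ₗ[k] A').rTensor L w + w * (D : A' →ₗ[k] A').rTensor L z := by
  induction z with
  | zero => simp
  | add x y hx hy => simp only [add_mul, mul_add, map_add, hx, hy]; ring
  | tmul x l =>
    induction w with
    | zero => simp
    | add x y hx hy => simp only [add_mul, mul_add, map_add, hx, hy]; ring
    | tmul y m => simp [TensorProduct.add_tmul, mul_comm m l]

/-- A `k`-linear derivation of `A'` extends to an `L`-linear derivation of `A' ⊗[k] L`. -/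
theorem Derivation.exists_extension (e : A' ⊗[k] L ≃ₐ[A'] A)
    (he : ∀ l : L, e (1 ⊗ₜ l) = algebraMap L A l) (D' : Derivation k A' A') :
    ∃ D : Derivation L A A, ∀ x, algebraMap A' A (D' x) = D (algebraMap A' A x) := by
  let θ : A →+ A := (e : A' ⊗[k] L →+ A).comp
    (((D' : A' →ₗ[k] A').rTensor L).toAddMonoidHom.comp (e.symm : A →+ A' ⊗[k] L))
  have hθ (a : A) : θ a = e ((D' : A' →ₗ[k] A').rTensor L (e.symm a)) := rfl
  have hmul (a b : A) : θ (a * b) = a * θ b + b * θ a := by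
    simp [hθ, Derivation.rTensor_leibniz]
  have hL (l : L) : θ (algebraMap L A l) = 0 := by
    rw [hθ, ← he, e.symm_apply_apply]
    simp
  refine ⟨Derivation.mk' { θ with map_smul' := fun l a => ?_ } hmul, fun x => ?_⟩
  · simp [Algebra.smul_def, hmul, hL]
  · change _ = θ (algebraMap A' A x)
    rw [hθ, ← e.commutes, ← e.commutes, e.symm_apply_apply]
    simp [Algebra.TensorProduct.algebraMap_apply]

/-- If `L` is finite over `k` and `A` is the pushout of `A'` along `k → L`, then `A` is finite free
over `A'`, `A' → A` splits, `L` spans `A` over `A'`, and derivations of `A'` extend to `A`. -/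
theorem exists_basis_of_isPushout [Module.Finite k L]
    (hcomm : ∀ t : k, algebraMap A' A (algebraMap k A' t) = algebraMap L A (algebraMap k L t))
    (huniv : ∀ (B : Type u) [CommRing B] (g : A' →+* B) (h : L →+* B),
      (∀ t : k, g (algebraMap k A' t) = h (algebraMap k L t)) →
      ∃! ψ : A →+* B, ψ.comp (algebraMap A' A) = g ∧ ψ.comp (algebraMap L A) = h) :
    ∃ (n : ℕ) (_ : Module.Basis (Fin n) A' A),
      Submodule.span A' (Set.range (algebraMap L A)) = ⊤ ∧ (∃ ρ : A →ₗ[A'] A', ρ 1 = 1) ∧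
      ∀ D' : Derivation k A' A', ∃ D : Derivation L A A,
        ∀ x, algebraMap A' A (D' x) = D (algebraMap A' A x) := by
  obtain ⟨e, he⟩ := exists_algEquiv_tensorProduct_of_isPushout hcomm huniv
  let b := (Algebra.TensorProduct.basis A' (Module.finBasis k L)).map e.toLinearEquiv
  obtain ⟨f, hf⟩ := (Algebra.linearMap k L).exists_leftInverse_of_injective
    (LinearMap.ker_eq_bot.2 (algebraMap k L).injective)
  refine ⟨_, b, ?_, ⟨((TensorProduct.AlgebraTensorModule.rid k A' A').toLinearMap.comp
    (f.baseChange A')).comp e.symm.toLinearMap, ?_⟩, Derivation.exists_extension e he⟩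
  · rw [eq_top_iff, ← b.span_eq]
    refine Submodule.span_mono ?_
    rintro _ ⟨i, rfl⟩
    exact ⟨Module.finBasis k L i, by simp [b, he]⟩
  · have : f 1 = 1 := by simpa using LinearMap.congr_fun hf 1
    simp [Algebra.TensorProduct.one_def, this]

end Pushout

theorem Module.Projective.restrictScalars_of_projective (R : Type*) {S M : Type*} [CommRing R]
    [CommRing S] [Algebra R S] [AddCommGroup M] [Module R M] [Module S M] [IsScalarTower R S M]
    [Module.Projective R S] [hM : Module.Projective S M] : Module.Projective R M := by
  obtain ⟨s, hs⟩ := hM.out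
  have : Module.Projective R (M →₀ S) := by
    classical exact .of_equiv' (finsuppLEquivDirectSum R S M).symm
  exact .of_split (s.restrictScalars R) ((Finsupp.linearCombination S id).restrictScalars R)
    (LinearMap.ext hs)

theorem Finset.prod_eq_finsuppProd_single {R ι α : Type*} [CommMonoid R] [Fintype α]
    (t : ι → R) (w : α → ι) :
    ∏ i, t (w i) = (∑ i, Finsupp.single (w i) 1 : ι →₀ ℕ).prod fun j n => t j ^ n := by
  classical
  rw [← Finsupp.prod_finsetSum_index (by simp) (by simp [pow_add])]
  simp

/-- If a polynomial map into `V` takes all its values in the subspace `N`, then so do its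
coefficients, hence also its values after extension of scalars. -/
theorem Submodule.sum_prod_smul_mem_of_forall {K V W C ι α : Type*} [Field K] [Infinite K]
    [AddCommGroup V] [Module K V] [CommRing C] [AddCommGroup W] [Module C W] [Fintype ι]
    [Fintype α] [DecidableEq α] {σ : K →+* C} (Φ : V →ₛₗ[σ] W) (N : Submodule K V) (P : Submodule C W)
    (hP : ∀ v ∈ N, Φ v ∈ P) (v : (α → ι) → V)
    (hv : ∀ t : ι → K, ∑ w, (∏ i, t (w i)) • v w ∈ N) (c : ι → C) :
    ∑ w, (∏ i, c (w i)) • Φ (v w) ∈ P := by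
  classical
  let m (w : α → ι) : ι →₀ ℕ := ∑ i, Finsupp.single (w i) 1
  have hmem (d : ι →₀ ℕ) : ∑ w with m w = d, v w ∈ N := by
    by_contra hd
    obtain ⟨φ, hφ, hN⟩ := N.exists_le_ker_of_notMem hd
    let q : MvPolynomial ι K := ∑ w, MvPolynomial.monomial (m w) (φ (v w))
    have hq : q = 0 := MvPolynomial.funext fun t => by
      have := hN (hv t)
      rw [LinearMap.mem_ker, map_sum] at this
      simp only [q, map_sum, MvPolynomial.eval_monomial, map_zero]
      rw [← this]
      exact Finset.sum_congr rfl fun w _ => by rw [map_smul, smul_eq_mul, Finset.prod_eq_finsuppProd_single, mul_comm]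
    have := congrArg (MvPolynomial.coeff d) hq
    rw [MvPolynomial.coeff_zero, MvPolynomial.coeff_sum] at this
    simp only [MvPolynomial.coeff_monomial, ← Finset.sum_filter] at this
    exact hφ (by rw [map_sum, this])
  rw [← Finset.sum_fiberwise_of_maps_to (t := Finset.univ.image m)
    fun w _ => Finset.mem_image_of_mem m (Finset.mem_univ w)]
  refine P.sum_mem fun d _ => ?_
  have : ∑ w with m w = d, (∏ i, c (w i)) • Φ (v w) =
      (d.prod fun j n => c j ^ n) • Φ (∑ w with m w = d, v w) := by
    rw [map_sum, Finset.smul_sum]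
    refine Finset.sum_congr rfl fun w hw => ?_
    rw [Finset.prod_eq_finsuppProd_single, show ∑ i, Finsupp.single (w i) 1 = d from (Finset.mem_filter.1 hw).2]
  rw [this]
  exact P.smul_mem _ (hP _ (hmem d))

section Descent

variable {K : Type u} [Field K] {p : ℕ} {A' A : Type u} [CommRing A'] [CommRing A]
  [Algebra K A] [Algebra A' A]

theorem LinearMap.apply_algebraMap_of_map_one {ρ : A →ₗ[A'] A'} (hρ : ρ 1 = 1) (x : A') :
    ρ (algebraMap A' A x) = x := by
  rw [Algebra.algebraMap_eq_smul_one, map_smul, hρ, smul_eq_mul, mul_one]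

theorem Derivation.sum_apply {ι : Type*} (s : Finset ι) (D : ι → Derivation K A A) (a : A) :
    (∑ i ∈ s, D i) a = ∑ i ∈ s, D i a :=
  map_sum ((Pi.evalAddMonoidHom _ a).comp Derivation.coeFnAddMonoidHom) D s

theorem LinearMap.ext_of_span_range_algebraMap
    (hspan : Submodule.span A' (Set.range (algebraMap K A)) = ⊤) {f g : A →ₗ[K] A}
    (h : ∀ x, f (algebraMap A' A x) = g (algebraMap A' A x)) : f = g := by
  ext a
  induction (hspan ▸ Submodule.mem_top : a ∈ Submodule.span A' (Set.range (algebraMap K A)))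
    using Submodule.closure_induction with
  | zero => simp
  | add a b _ _ ha hb => simp [ha, hb]
  | smul_mem x a ha =>
    obtain ⟨t, rfl⟩ := ha
    rw [Algebra.smul_def, mul_comm, ← Algebra.smul_def, map_smul, map_smul, h]

theorem Derivation.ext_of_span_range_algebraMap
    (hspan : Submodule.span A' (Set.range (algebraMap K A)) = ⊤) {D E : Derivation K A A}
    (h : ∀ x, D (algebraMap A' A x) = E (algebraMap A' A x)) : D = E :=
  Derivation.ext <| LinearMap.congr_fun <|
    LinearMap.ext_of_span_range_algebraMap hspan (f := (D : A →ₗ[K] A)) (g := E) h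

variable [Algebra K A'] {ℱ : Submodule A (Derivation K A A)}
  {ℱ' : Submodule A' (Derivation K A' A')}

theorem IsDistributionModel.mem_of_lifts (hmodel : IsDistributionModel K (algebraMap A' A) ℱ' ℱ)
    (hspan : Submodule.span A' (Set.range (algebraMap K A)) = ⊤)
    {D : Derivation K A A} {D' : Derivation K A' A'} (hD' : D' ∈ ℱ')
    (h : ∀ x, algebraMap A' A (D' x) = D (algebraMap A' A x)) : D ∈ ℱ := by
  obtain ⟨E, hE, hE'⟩ := hmodel.descends D' hD'
  rwa [Derivation.ext_of_span_range_algebraMap hspan fun x => (h x).symm.trans (hE' x)]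

variable [SMulCommClass K A' A]

/-- Composing a derivation of `A` with an `A'`-linear map `ρ : A → A'` yields a derivation
of `A'`. -/
def Derivation.restrictAlong
    (hsemi : ∀ t : K, algebraMap A' A (algebraMap K A' t) = algebraMap K A (t ^ p))
    (ρ : A →ₗ[A'] A') : Derivation K A A →ₗ[A'] Derivation K A' A' where
  toFun D := Derivation.mk'
    { toFun := fun x => ρ (D (algebraMap A' A x))
      map_add' := by simp
      map_smul' := fun t x => by
        rw [Algebra.smul_def, map_mul, hsemi, D.leibniz, D.map_algebraMap, smul_zero, add_zero,
          ← hsemi, algebraMap_smul, ρ.map_smul, algebraMap_smul, RingHom.id_apply] }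
    fun x y => by
      simp only [LinearMap.coe_mk, AddHom.coe_mk, map_mul, D.leibniz, map_add, algebraMap_smul,
        ρ.map_smul]
  map_add' D E := by ext; simp
  map_smul' x D := by ext; simp

@[simp]
theorem Derivation.restrictAlong_apply
    (hsemi : ∀ t : K, algebraMap A' A (algebraMap K A' t) = algebraMap K A (t ^ p))
    (ρ : A →ₗ[A'] A') (D : Derivation K A A) (x : A') :
    Derivation.restrictAlong hsemi ρ D x = ρ (D (algebraMap A' A x)) := rfl

theorem Derivation.restrictAlong_eq_of_lifts
    (hsemi : ∀ t : K, algebraMap A' A (algebraMap K A' t) = algebraMap K A (t ^ p))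
    (ρ : A →ₗ[A'] A') {D : Derivation K A A} {D' : Derivation K A' A'}
    (h : ∀ x, algebraMap A' A (D' x) = D (algebraMap A' A x)) (a : A) :
    Derivation.restrictAlong hsemi ρ (a • D) = ρ a • D' := by
  ext x
  simp [← h, mul_comm a, ← Algebra.smul_def, mul_comm (ρ a)]

namespace IsDistributionModel

theorem restrictAlong_mem (hmodel : IsDistributionModel K (algebraMap A' A) ℱ' ℱ)
    (hsemi : ∀ t : K, algebraMap A' A (algebraMap K A' t) = algebraMap K A (t ^ p))
    (ρ : A →ₗ[A'] A') {D : Derivation K A A} (hD : D ∈ ℱ) :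
    Derivation.restrictAlong hsemi ρ D ∈ ℱ' := by
  replace hD := hmodel.spans hD
  induction hD using Submodule.closure_induction with
  | zero => simp
  | add D E _ _ hD hE => simpa using ℱ'.add_mem hD hE
  | smul_mem a D hD =>
    obtain ⟨D', hD', h⟩ := hD
    rw [Derivation.restrictAlong_eq_of_lifts hsemi ρ h]
    exact ℱ'.smul_mem _ hD'

/-- A map `A' → A'` which lifts to an element of `ℱ` is an element of `ℱ'`. -/
theorem exists_mem_of_lifts (hmodel : IsDistributionModel K (algebraMap A' A) ℱ' ℱ)
    (hsemi : ∀ t : K, algebraMap A' A (algebraMap K A' t) = algebraMap K A (t ^ p))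
    {ρ : A →ₗ[A'] A'} (hρ : ρ 1 = 1) {D : Derivation K A A} (hD : D ∈ ℱ) {f : A' → A'}
    (h : ∀ x, algebraMap A' A (f x) = D (algebraMap A' A x)) : ∃ D' ∈ ℱ', ∀ x, D' x = f x :=
  ⟨_, hmodel.restrictAlong_mem hsemi ρ hD, fun x => by
    rw [Derivation.restrictAlong_apply, ← h, LinearMap.apply_algebraMap_of_map_one hρ]⟩

theorem isLieClosed_iff (hmodel : IsDistributionModel K (algebraMap A' A) ℱ' ℱ)
    (hsemi : ∀ t : K, algebraMap A' A (algebraMap K A' t) = algebraMap K A (t ^ p))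
    (hspan : Submodule.span A' (Set.range (algebraMap K A)) = ⊤)
    {ρ : A →ₗ[A'] A'} (hρ : ρ 1 = 1) :
    Distribution.IsLieClosed K ℱ ↔ Distribution.IsLieClosed K ℱ' := by
  have hlie {D E : Derivation K A A} {D' E' : Derivation K A' A'}
      (hD : ∀ x, algebraMap A' A (D' x) = D (algebraMap A' A x))
      (hE : ∀ x, algebraMap A' A (E' x) = E (algebraMap A' A x)) (x : A') :
      algebraMap A' A (⁅D', E'⁆ x) = ⁅D, E⁆ (algebraMap A' A x) := by
    simp [Derivation.commutator_apply, hD, hE]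
  constructor
  · intro h D' hD' E' hE'
    obtain ⟨D, hD, hDD'⟩ := hmodel.descends D' hD'
    obtain ⟨E, hE, hEE'⟩ := hmodel.descends E' hE'
    obtain ⟨G, hG, hGx⟩ := hmodel.exists_mem_of_lifts hsemi hρ (h D hD E hE) (hlie hDD' hEE')
    rwa [← Derivation.ext hGx]
  · intro h D hD E hE
    have hsmul (a : A) (D E : Derivation K A A) : ⁅D, a • E⁆ = a • ⁅D, E⁆ + D a • E := by
      ext x
      simp only [Derivation.commutator_apply, Derivation.smul_apply, Derivation.add_apply,
        smul_eq_mul, Derivation.leibniz]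
      ring
    have hgen {D E : Derivation K A A} (hE : E ∈ ℱ)
        (hD : ∃ D' ∈ ℱ', ∀ x, algebraMap A' A (D' x) = D (algebraMap A' A x)) : ⁅D, E⁆ ∈ ℱ := by
      replace hE := hmodel.spans hE
      induction hE using Submodule.closure_induction with
      | zero => simp
      | add E G _ _ hE hG => simpa using ℱ.add_mem hE hG
      | smul_mem a E hE =>
        obtain ⟨D', hD', hDD'⟩ := hD
        obtain ⟨E', hE', hEE'⟩ := hE
        rw [hsmul]
        exact ℱ.add_mem
          (ℱ.smul_mem _ (hmodel.mem_of_lifts hspan (h D' hD' E' hE') (hlie hDD' hEE')))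
          (ℱ.smul_mem _ (hmodel.mem_of_lifts hspan hE' hEE'))
    replace hD := hmodel.spans hD
    induction hD using Submodule.closure_induction with
    | zero => simp
    | add D G _ _ hD hG => simpa using ℱ.add_mem hD hG
    | smul_mem a D hD =>
      rw [← lie_skew, hsmul, ← lie_skew]
      obtain ⟨D', hD', hDD'⟩ := id hD
      exact ℱ.neg_mem (ℱ.add_mem (ℱ.smul_mem _ (ℱ.neg_mem (hgen hE hD)))
        (ℱ.smul_mem _ (hmodel.mem_of_lifts hspan hD' hDD')))

/-- `ℱ` is already spanned over `K` by the lifts of elements of `ℱ'`. -/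
theorem mem_span_lifts (hmodel : IsDistributionModel K (algebraMap A' A) ℱ' ℱ)
    (hspan : Submodule.span A' (Set.range (algebraMap K A)) = ⊤)
    {D : Derivation K A A} (hD : D ∈ ℱ) :
    D ∈ Submodule.span K
      {D : Derivation K A A | ∃ D' ∈ ℱ', ∀ x, algebraMap A' A (D' x) = D (algebraMap A' A x)} := by
  replace hD := hmodel.spans hD
  induction hD using Submodule.closure_induction with
  | zero => exact Submodule.zero_mem _
  | add D E _ _ hD hE => exact Submodule.add_mem _ hD hE
  | smul_mem a D hD =>
    obtain ⟨D', hD', h⟩ := hD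
    induction (hspan ▸ Submodule.mem_top : a ∈ Submodule.span A' (Set.range (algebraMap K A)))
      using Submodule.closure_induction with
    | zero => simp
    | add a b _ _ ha hb => rw [add_smul]; exact Submodule.add_mem _ ha hb
    | smul_mem x a ha =>
      obtain ⟨t, rfl⟩ := ha
      have : (x • algebraMap K A t) • D = t • (algebraMap A' A x • D) := by
        ext y
        simp only [Derivation.smul_apply, Algebra.smul_def, Algebra.algebraMap_self, RingHom.id_apply]
        ring
      rw [this]
      refine Submodule.smul_mem _ _ (Submodule.subset_span ⟨x • D', ℱ'.smul_mem _ hD', ?_⟩)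
      intro y
      simp [h, Algebra.smul_def]

theorem isPClosed_of_model (hmodel : IsDistributionModel K (algebraMap A' A) ℱ' ℱ)
    (hsemi : ∀ t : K, algebraMap A' A (algebraMap K A' t) = algebraMap K A (t ^ p))
    (h : Distribution.IsPClosed K p ℱ) {ρ : A →ₗ[A'] A'} (hρ : ρ 1 = 1) :
    Distribution.IsPClosed K p ℱ' := by
  intro D' hD'
  obtain ⟨D, hD, hDD'⟩ := hmodel.descends D' hD'
  obtain ⟨E, hE, hED⟩ := h D hD
  refine hmodel.exists_mem_of_lifts hsemi hρ hE fun x => ?_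
  rw [hED]
  exact Function.Semiconj.iterate_right (f := algebraMap A' A) hDD' p x

end IsDistributionModel

end Descent

theorem Finset.sum_smul_pow {R B ι : Type*} [CommSemiring R] [Semiring B] [Algebra R B]
    [Fintype ι] (c : ι → R) (d : ι → B) (n : ℕ) :
    (∑ i, c i • d i) ^ n =
      ∑ w : Fin n → ι, (∏ j, c (w j)) • (List.ofFn fun j => d (w j)).prod := by
  classical
  rw [← MultilinearMap.mkPiAlgebraFin_apply_const (R := R), MultilinearMap.map_sum]
  exact Finset.sum_congr rfl fun w _ => MultilinearMap.map_smul_univ _ _ _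

namespace IsDistributionModel

variable {K : Type u} [Field K] {p : ℕ} {A' A : Type u} [CommRing A'] [CommRing A]
  [Algebra K A'] [Algebra K A] [Algebra A' A] {ℱ : Submodule A (Derivation K A A)}
  {ℱ' : Submodule A' (Derivation K A' A')}

theorem exists_mem_pow_of_infinite [Infinite K] [Fact p.Prime] [CharP K p]
    (hmodel : IsDistributionModel K (algebraMap A' A) ℱ' ℱ)
    (hsemi : ∀ t : K, algebraMap A' A (algebraMap K A' t) = algebraMap K A (t ^ p))
    (hspan : Submodule.span A' (Set.range (algebraMap K A)) = ⊤)
    (h : Distribution.IsPClosed K p ℱ') {D : Derivation K A A} (hD : D ∈ ℱ) :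
    ∃ E ∈ ℱ, ∀ x, E (algebraMap A' A x) = D^[p] (algebraMap A' A x) := by
  obtain ⟨n, c, g, rfl⟩ := Submodule.mem_span_set'.1 (hmodel.mem_span_lifts hspan hD)
  choose D' hD' hlift using fun i => (g i).2
  let Φ : Module.End K A' →ₛₗ[(algebraMap K A).comp (frobenius K p)] (A' → A) :=
    { toFun := fun f x => algebraMap A' A (f x)
      map_add' := fun f g => by ext; simp
      map_smul' := fun t f => by ext; simp [Algebra.smul_def, hsemi, frobenius_def] }
  let N : Submodule K (Module.End K A') :=
    { carrier := {f | ∃ E ∈ ℱ', ↑E = f}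
      add_mem' := by
        rintro _ _ ⟨E, hE, rfl⟩ ⟨G, hG, rfl⟩
        exact ⟨E + G, ℱ'.add_mem hE hG, rfl⟩
      zero_mem' := ⟨0, ℱ'.zero_mem, rfl⟩
      smul_mem' := by
        rintro t _ ⟨E, hE, rfl⟩
        refine ⟨t • E, ?_, rfl⟩
        rw [← algebraMap_smul A' t E]
        exact ℱ'.smul_mem _ hE }
  let P : Submodule A (A' → A) :=
    { carrier := {f | ∃ E ∈ ℱ, ∀ x, E (algebraMap A' A x) = f x}
      add_mem' := by
        rintro _ _ ⟨E, hE, hEf⟩ ⟨G, hG, hGf⟩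
        exact ⟨E + G, ℱ.add_mem hE hG, fun x => by simp [hEf, hGf]⟩
      zero_mem' := ⟨0, ℱ.zero_mem, fun x => rfl⟩
      smul_mem' := by
        rintro a _ ⟨E, hE, hEf⟩
        exact ⟨a • E, ℱ.smul_mem a hE, fun x => by simp [hEf]⟩ }
  have hP : ∀ f ∈ N, Φ f ∈ P := by
    rintro _ ⟨E', hE', rfl⟩
    obtain ⟨E, hE, hEE'⟩ := hmodel.descends E' hE'
    exact ⟨E, hE, fun x => (hEE' x).symm⟩
  obtain ⟨E, hE, hEx⟩ := N.sum_prod_smul_mem_of_forall Φ P hP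
    (fun w : Fin p → Fin n => (List.ofFn fun j => (D' (w j) : Module.End K A')).prod)
    (fun t => by
      rw [show ∑ w : Fin p → Fin n, (∏ j, t (w j)) •
          (List.ofFn fun j => (D' (w j) : Module.End K A')).prod = (∑ i, t i • ↑(D' i)) ^ p from
        (Finset.sum_smul_pow t (fun i => (D' i : Module.End K A')) p).symm]
      obtain ⟨G, hG, hGp⟩ := h (∑ i, t i • D' i) <| ℱ'.sum_mem fun i _ => by
        rw [← algebraMap_smul A' (t i) (D' i)]
        exact ℱ'.smul_mem _ (hD' i)
      refine ⟨G, hG, LinearMap.ext fun x => ?_⟩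
      rw [Module.End.pow_apply]
      refine (hGp x).trans (congrArg (fun f => f^[p] x) (funext fun y => ?_))
      simp [Derivation.sum_apply])
    (fun i => algebraMap K A (c i))
  refine ⟨E, hE, fun x => ?_⟩
  have hpow := Finset.sum_smul_pow c (fun i => ((g i : Derivation K A A) : Module.End K A)) p
  have hprod (l : List (Fin n)) :
      algebraMap A' A ((l.map fun i => (D' i : Module.End K A')).prod x) =
        (l.map fun i => ((g i : Derivation K A A) : Module.End K A)).prod (algebraMap A' A x) := by
    induction l with
    | nil => simp
    | cons i l ih =>
      simp only [List.map_cons, List.prod_cons, Module.End.mul_apply]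
      rw [← ih]
      exact hlift i _
  have hD (a : A) : (⇑(∑ i, c i • (g i : Derivation K A A)))^[p] a =
      ((∑ i, c i • ((g i : Derivation K A A) : Module.End K A)) ^ p) a := by
    rw [Module.End.pow_apply]
    refine congrArg (fun f => f^[p] a) (funext fun y => ?_)
    simp [Derivation.sum_apply]
  rw [hEx, hD, hpow, Finset.sum_apply, LinearMap.sum_apply]
  refine Finset.sum_congr rfl fun w _ => ?_
  have := hprod (List.ofFn w)
  simp only [List.map_ofFn, Function.comp_def] at this
  rw [Pi.smul_apply, LinearMap.smul_apply, ← this, ← map_prod, algebraMap_smul]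
  rfl

theorem exists_mem_pow_of_surjective
    (hmodel : IsDistributionModel K (algebraMap A' A) ℱ' ℱ) [SMulCommClass K A' A]
    (hsemi : ∀ t : K, algebraMap A' A (algebraMap K A' t) = algebraMap K A (t ^ p))
    (hsurj : Function.Surjective (algebraMap A' A)) {ρ : A →ₗ[A'] A'} (hρ : ρ 1 = 1)
    (h : Distribution.IsPClosed K p ℱ') {D : Derivation K A A} (hD : D ∈ ℱ) :
    ∃ E ∈ ℱ, ∀ x, E (algebraMap A' A x) = D^[p] (algebraMap A' A x) := by
  obtain ⟨E', hE', hEp⟩ := h _ (hmodel.restrictAlong_mem hsemi ρ hD)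
  obtain ⟨E, hE, hEE'⟩ := hmodel.descends E' hE'
  refine ⟨E, hE, fun x => ?_⟩
  rw [← hEE', hEp]
  refine Function.Semiconj.iterate_right (f := algebraMap A' A) (fun y => ?_) p x
  obtain ⟨z, hz⟩ := hsurj (D (algebraMap A' A y))
  rw [Derivation.restrictAlong_apply, ← hz, LinearMap.apply_algebraMap_of_map_one hρ]

theorem isPClosed_iff [Fact p.Prime] [CharP K p] [SMulCommClass K A' A]
    (hmodel : IsDistributionModel K (algebraMap A' A) ℱ' ℱ)
    (hsemi : ∀ t : K, algebraMap A' A (algebraMap K A' t) = algebraMap K A (t ^ p))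
    (hspan : Submodule.span A' (Set.range (algebraMap K A)) = ⊤)
    {ρ : A →ₗ[A'] A'} (hρ : ρ 1 = 1) :
    Distribution.IsPClosed K p ℱ ↔ Distribution.IsPClosed K p ℱ' := by
  refine ⟨fun h => hmodel.isPClosed_of_model hsemi h hρ, fun h D hD => ?_⟩
  have hE : ∃ E ∈ ℱ, ∀ x, E (algebraMap A' A x) = D^[p] (algebraMap A' A x) := by
    cases finite_or_infinite K with
    | inr _ => exact hmodel.exists_mem_pow_of_infinite hsemi hspan h hD
    | inl _ =>
      refine hmodel.exists_mem_pow_of_surjective hsemi (fun a => ?_) hρ h hD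
      induction (hspan ▸ Submodule.mem_top : a ∈ Submodule.span A' (Set.range (algebraMap K A)))
        using Submodule.span_induction with
      | mem a ha =>
        obtain ⟨t, rfl⟩ := ha
        obtain ⟨s, rfl⟩ := (Finite.injective_iff_surjective.1 (frobenius_inj K p)) t
        exact ⟨_, hsemi s⟩
      | zero => exact ⟨0, map_zero _⟩
      | add a b _ _ ha hb =>
        obtain ⟨⟨x, rfl⟩, y, rfl⟩ := And.intro ha hb
        exact ⟨x + y, map_add _ _ _⟩
      | smul y a _ ha =>
        obtain ⟨x, rfl⟩ := ha
        exact ⟨y * x, by rw [map_mul, Algebra.smul_def]⟩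
  obtain ⟨E, hE, hEx⟩ := hE
  refine ⟨E, hE, fun a => ?_⟩
  have := LinearMap.ext_of_span_range_algebraMap hspan (f := (E : A →ₗ[K] A))
    (g := (D : Module.End K A) ^ p) fun x => by
      rw [Module.End.pow_apply]
      exact hEx x
  exact (LinearMap.congr_fun this a).trans (Module.End.pow_apply _ _ _)

/-- The `A'`-linear map `Θ_A / ℱ → Θ_A' / ℱ'` induced by an `A'`-linear map `A → A'`. -/
def quotientRestrict [SMulCommClass K A' A]
    (hmodel : IsDistributionModel K (algebraMap A' A) ℱ' ℱ)
    (hsemi : ∀ t : K, algebraMap A' A (algebraMap K A' t) = algebraMap K A (t ^ p))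
    (ρ : A →ₗ[A'] A') : (Derivation K A A ⧸ ℱ) →ₗ[A'] (Derivation K A' A' ⧸ ℱ') :=
  (Submodule.mapQ (ℱ.restrictScalars A') ℱ' (Derivation.restrictAlong hsemi ρ)
    fun _ hD => hmodel.restrictAlong_mem hsemi ρ hD).comp
    (Submodule.Quotient.restrictScalarsEquiv A' ℱ).symm.toLinearMap

theorem quotientRestrict_mk [SMulCommClass K A' A]
    (hmodel : IsDistributionModel K (algebraMap A' A) ℱ' ℱ)
    (hsemi : ∀ t : K, algebraMap A' A (algebraMap K A' t) = algebraMap K A (t ^ p))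
    (ρ : A →ₗ[A'] A') (D : Derivation K A A) :
    hmodel.quotientRestrict hsemi ρ (ℱ.mkQ D) =
      ℱ'.mkQ (Derivation.restrictAlong hsemi ρ D) := rfl

theorem isRegular_iff [SMulCommClass K A' A]
    (hmodel : IsDistributionModel K (algebraMap A' A) ℱ' ℱ)
    (hsemi : ∀ t : K, algebraMap A' A (algebraMap K A' t) = algebraMap K A (t ^ p))
    (hspan : Submodule.span A' (Set.range (algebraMap K A)) = ⊤)
    {ι : Type*} [Fintype ι] (b : Module.Basis ι A' A) {ρ : A →ₗ[A'] A'} (hρ : ρ 1 = 1)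
    (hext : ∀ D' : Derivation K A' A', ∃ D : Derivation K A A,
      ∀ x, algebraMap A' A (D' x) = D (algebraMap A' A x)) :
    Distribution.IsRegular K ℱ ↔ Distribution.IsRegular K ℱ' := by
  choose e he using hext
  let ε : Derivation K A' A' →ₗ[A'] Derivation K A A :=
    { toFun := e
      map_add' := fun D E => Derivation.ext_of_span_range_algebraMap hspan fun x => by
        simp [← he]
      map_smul' := fun y D => Derivation.ext_of_span_range_algebraMap hspan fun x => by
        simp [← he, Algebra.smul_def] }
  have hε (D' : Derivation K A' A') (x : A') :
      algebraMap A' A (D' x) = ε D' (algebraMap A' A x) := he D' x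
  let i : (Derivation K A' A' ⧸ ℱ') →ₗ[A'] (Derivation K A A ⧸ ℱ) :=
    ℱ'.liftQ ((ℱ.mkQ.restrictScalars A').comp ε) fun D' hD' =>
      (Submodule.Quotient.mk_eq_zero ℱ).2 (hmodel.mem_of_lifts hspan hD' (hε D'))
  have hi (D' : Derivation K A' A') : i (ℱ'.mkQ D') = ℱ.mkQ (ε D') := rfl
  let r := hmodel.quotientRestrict hsemi
  have hri (σ : A →ₗ[A'] A') (a : A) (m : Derivation K A' A' ⧸ ℱ') :
      r σ (a • i m) = σ a • m := by
    obtain ⟨D', rfl⟩ := ℱ'.mkQ_surjective m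
    rw [hi, ← map_smul, hmodel.quotientRestrict_mk,
      Derivation.restrictAlong_eq_of_lifts hsemi σ (hε D'), map_smul]
  constructor
  · intro (_ : Module.Projective A _)
    have : Module.Projective A' A := .of_basis b
    have : Module.Projective A' (Derivation K A A ⧸ ℱ) := .restrictScalars_of_projective A' (S := A)
    refine Module.Projective.of_split i (r ρ) (LinearMap.ext fun m => ?_)
    simpa [hρ] using hri ρ 1 m
  · intro (_ : Module.Projective A' _)
    let H : A ⊗[A'] (Derivation K A' A' ⧸ ℱ') →ₗ[A] (Derivation K A A ⧸ ℱ) :=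
      i.liftBaseChange A
    let G (m : Derivation K A A ⧸ ℱ) : A ⊗[A'] (Derivation K A' A' ⧸ ℱ') :=
      ∑ j, b j ⊗ₜ r (b.coord j) m
    have hGH (z) : G (H z) = z := by
      induction z with
      | zero => simp [G]
      | add z w hz hw =>
        rw [map_add]
        nth_rw 2 [← hz, ← hw]
        simp [G, TensorProduct.tmul_add, Finset.sum_add_distrib]
      | tmul a m =>
        simp only [H, G, LinearMap.liftBaseChange_tmul, hri, TensorProduct.tmul_smul,
          TensorProduct.smul_tmul', ← TensorProduct.sum_tmul, Module.Basis.coord_apply, b.sum_repr]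
    have hHG (m) : H (G m) = m := by
      obtain ⟨D, rfl⟩ := ℱ.mkQ_surjective m
      simp only [G, H, map_sum, LinearMap.liftBaseChange_tmul, r, hmodel.quotientRestrict_mk, hi]
      simp only [← map_smul, ← map_sum]
      congr 1
      refine Derivation.ext_of_span_range_algebraMap hspan fun x => ?_
      simp only [Derivation.sum_apply, Derivation.smul_apply, ← hε,
        Derivation.restrictAlong_apply, smul_eq_mul]
      conv_rhs => rw [← b.sum_repr (D (algebraMap A' A x))]
      exact Finset.sum_congr rfl fun j _ => by
        rw [Module.Basis.coord_apply, Algebra.smul_def, mul_comm]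
    exact Module.Projective.of_equiv' (LinearEquiv.ofBijective H
      ⟨Function.LeftInverse.injective hGH, fun m => ⟨G m, hHG m⟩⟩)

end IsDistributionModel

/-- For a descent pair `(X, X̃)` and a distribution `ℱ ⊆ Θ_{X/K}` with
model `ℱ' ⊆ Θ_{X̃/K}`:  `ℱ` is a foliation (resp. `p`-closed) iff `ℱ'` is a foliation
(resp. `p`-closed), and, if `X` is smooth, `ℱ` is regular iff `ℱ'` is regular. -/
theorem foliation_pclosed_regular_iff_model
    (K : Type u) [Field K] (p : ℕ) [Fact p.Prime] [CharP K p] (hFF : IsFFinite K p)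
    (A' A : Type u) [CommRing A'] [CommRing A] [Algebra K A'] [Algebra K A]
    [Algebra.FiniteType K A] [Algebra.FiniteType K A']
    (F : A' →+* A) (hF : IsFrobeniusModel K p A' A F)
    (ℱ : Submodule A (Derivation K A A)) (ℱ' : Submodule A' (Derivation K A' A'))
    (hdist : Distribution.IsSaturated K ℱ) (hdist' : Distribution.IsSaturated K ℱ')
    (hmodel : IsDistributionModel K F ℱ' ℱ) :
    (Distribution.IsFoliation K ℱ ↔ Distribution.IsFoliation K ℱ') ∧
    (Distribution.IsPClosed K p ℱ ↔ Distribution.IsPClosed K p ℱ') ∧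
    (Algebra.Smooth K A →
      (Distribution.IsRegular K ℱ ↔ Distribution.IsRegular K ℱ')) := by
  let _ : Algebra A' A := F.toAlgebra
  have hsemi : ∀ t : K, algebraMap A' A (algebraMap K A' t) = algebraMap K A (t ^ p) :=
    hF.semilinear
  have : SMulCommClass K A' A := ⟨fun t x a => by
    simp only [Algebra.smul_def, mul_left_comm]⟩
  obtain ⟨n, b, hspan, ⟨ρ, hρ⟩, hext⟩ :=
    @exists_basis_of_isPushout K K A' A _ _ _ _ (frobenius K p).toAlgebra _ _ _ hFF hsemi
      hF.isPushout
  exact ⟨and_congr (iff_of_true hdist hdist') (hmodel.isLieClosed_iff hsemi hspan hρ),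
    hmodel.isPClosed_iff hsemi hspan hρ, fun _ => hmodel.isRegular_iff hsemi hspan b hρ hext⟩
end

section
/- Let K be an F-finite field of characteristic p > 0, X a K-variety with model X̃ over K^p, and ℱ a p-closed foliation on X that descends to ℱ̃ on X̃. Then the quotient X̃/ℱ̃ is a model of the quotient X/ℱ over K^p. -/
/-!
# Statement 6

Let `ℱ` be a `p`-closed foliation on `X` descending to `ℱ'` on a model `X̃` of
`X` over `K^p`.  Then `X̃/ℱ'` is a model of `X/ℱ` over `K^p`.  Formulated on an
affine chart `X = Spec A`, `X̃ = Spec A'` with model map `F : A' →+* A`: the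
restriction of `F` to the invariant subalgebras `A'^{ℱ'} → A^{ℱ}` is a
Frobenius model map.
-/

universe u

section BaseChange

open scoped TensorProduct

variable {K L A' A : Type u} [Field K] [Field L]
  [CommRing A'] [CommRing A] [Algebra K A'] [Algebra L A]

/-- A derivation lying over `D'` acts coordinatewise. -/
theorem Derivation.apply_sum_coordinates {ι : Type*} (c : ι → L) {F : A' →+* A}
    {D' : Derivation K A' A'} {D : Derivation L A A} (h : ∀ x, F (D' x) = D (F x))
    (x : ι →₀ A') :
    D (x.sum fun i y => algebraMap L A (c i) * F y) =
      (x.mapRange D' (map_zero D')).sum fun i y => algebraMap L A (c i) * F y := by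
  rw [Finsupp.sum_mapRange_index (by simp), Finsupp.sum, Finsupp.sum, map_sum]
  refine Finset.sum_congr rfl fun i _ => ?_
  rw [← Algebra.smul_def, D.map_smul, ← h, Algebra.smul_def]

/-- Membership in the invariant ring only needs to be tested on derivations which generate. -/
theorem Distribution.mem_fixedSubalgebra_of_le_span {ℱ : Submodule A (Derivation L A A)}
    {S : Set (Derivation L A A)} (hS : ℱ ≤ Submodule.span A S) {a : A}
    (ha : ∀ D ∈ S, D a = 0) : a ∈ Distribution.fixedSubalgebra L ℱ := by
  intro D hD
  have hmem := hS hD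
  clear hD
  induction hmem using Submodule.span_induction with
  | mem D hD => exact ha D hD
  | zero => rfl
  | add D₁ D₂ _ _ h₁ h₂ => rw [Derivation.add_apply, h₁, h₂, add_zero]
  | smul c D _ h => rw [Derivation.smul_apply, h, smul_zero]

variable [Algebra K L]

/-- `F : A' →+* A` exhibits `A` as the pushout of `L ← K → A'`, in terms of the universal
property. -/
structure IsFieldBaseChange (K L : Type u) [Field K] [Field L] [Algebra K L] {A' A : Type u}
    [CommRing A'] [CommRing A] [Algebra K A'] [Algebra L A] (F : A' →+* A) : Prop where
  semilinear : ∀ t : K, F (algebraMap K A' t) = algebraMap L A (algebraMap K L t)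
  isPushout : ∀ (B : Type u) [CommRing B] (g : A' →+* B) (h : L →+* B),
    (∀ t : K, g (algebraMap K A' t) = h (algebraMap K L t)) →
    ∃! ψ : A →+* B, ψ.comp F = g ∧ ψ.comp (algebraMap L A) = h

/-- The ring homomorphism `L ⊗[K] A' → B` induced by two ring homomorphisms which agree on `K`. -/
noncomputable def tensorLiftRingHom {B : Type u} [CommRing B] (g : A' →+* B) (h : L →+* B)
    (hgh : ∀ t : K, g (algebraMap K A' t) = h (algebraMap K L t)) : L ⊗[K] A' →+* B :=
  letI : Algebra K B := (h.comp (algebraMap K L)).toAlgebra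
  (Algebra.TensorProduct.productMap (R := K) (⟨h, fun _ => rfl⟩ : L →ₐ[K] B)
    (⟨g, hgh⟩ : A' →ₐ[K] B)).toRingHom

theorem tensorLiftRingHom_tmul {B : Type u} [CommRing B] (g : A' →+* B) (h : L →+* B)
    (hgh : ∀ t : K, g (algebraMap K A' t) = h (algebraMap K L t)) (l : L) (x : A') :
    tensorLiftRingHom g h hgh (l ⊗ₜ[K] x) = h l * g x := by
  let _ : Algebra K B := (h.comp (algebraMap K L)).toAlgebra
  exact Algebra.TensorProduct.productMap_apply_tmul (R := K) (⟨h, fun _ => rfl⟩ : L →ₐ[K] B)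
    (⟨g, hgh⟩ : A' →ₐ[K] B) l x

theorem tensorProduct_ringHom_ext {B : Type u} [CommRing B] {f₁ f₂ : L ⊗[K] A' →+* B}
    (h : ∀ l x, f₁ (l ⊗ₜ[K] x) = f₂ (l ⊗ₜ[K] x)) : f₁ = f₂ := by
  refine RingHom.ext fun z => ?_
  induction z with
  | zero => simp
  | tmul l x => exact h l x
  | add y z hy hz => rw [map_add, map_add, hy, hz]

/-- The pushout property is equivalent to bijectivity of `L ⊗[K] A' → A`. -/
theorem isFieldBaseChange_iff_bijective (F : A' →+* A)
    (hs : ∀ t : K, F (algebraMap K A' t) = algebraMap L A (algebraMap K L t)) :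
    IsFieldBaseChange K L F ↔
      Function.Bijective (tensorLiftRingHom F (algebraMap L A) hs) := by
  constructor
  · intro hF
    obtain ⟨ψ, ⟨hψF, hψL⟩, -⟩ := hF.isPushout (L ⊗[K] A')
      (Algebra.TensorProduct.includeRight : A' →ₐ[K] L ⊗[K] A').toRingHom
      Algebra.TensorProduct.includeLeftRingHom (fun t => by simp)
    have h₁ : ∀ x, ψ (F x) = 1 ⊗ₜ x := fun x => DFunLike.congr_fun hψF x
    have h₂ : ∀ l, ψ (algebraMap L A l) = l ⊗ₜ 1 := fun l => DFunLike.congr_fun hψL l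
    have hleft : ψ.comp (tensorLiftRingHom F (algebraMap L A) hs) = RingHom.id _ :=
      tensorProduct_ringHom_ext fun l x => by
        simp [tensorLiftRingHom_tmul, h₁, h₂]
    have hright : (tensorLiftRingHom F (algebraMap L A) hs).comp ψ = RingHom.id _ := by
      refine (hF.isPushout A F (algebraMap L A) hs).unique ⟨?_, ?_⟩ ⟨rfl, rfl⟩
      · ext x
        simp [h₁, tensorLiftRingHom_tmul]
      · ext l
        simp [h₂, tensorLiftRingHom_tmul]
    exact Function.bijective_iff_has_inverse.mpr
      ⟨ψ, DFunLike.congr_fun hleft, DFunLike.congr_fun hright⟩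
  · intro hbij
    let e := RingEquiv.ofBijective _ hbij
    have he : ∀ l x, e (l ⊗ₜ x) = algebraMap L A l * F x :=
      fun l x => tensorLiftRingHom_tmul F (algebraMap L A) hs l x
    have heF : ∀ x, e.symm (F x) = 1 ⊗ₜ x := fun x => by
      rw [RingEquiv.symm_apply_eq, he, map_one, one_mul]
    have heL : ∀ l, e.symm (algebraMap L A l) = l ⊗ₜ 1 := fun l => by
      rw [RingEquiv.symm_apply_eq, he, map_one, mul_one]
    refine ⟨hs, fun B _ g h hgh => ⟨(tensorLiftRingHom g h hgh).comp e.symm.toRingHom,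
      ⟨?_, ?_⟩, ?_⟩⟩
    · ext x
      simp [heF, tensorLiftRingHom_tmul]
    · ext l
      simp [heL, tensorLiftRingHom_tmul]
    · rintro ψ ⟨rfl, rfl⟩
      ext a
      obtain ⟨z, rfl⟩ := e.surjective a
      have : ψ.comp e.toRingHom = tensorLiftRingHom (ψ.comp F) (ψ.comp (algebraMap L A)) hgh :=
        tensorProduct_ringHom_ext fun l x => by simp [he, tensorLiftRingHom_tmul]
      simpa using DFunLike.congr_fun this z

/-- The pushout property in coordinates: given a basis `b` of `L` over `K`, every element of `A`
is uniquely of the form `∑ i, b i * F (x i)`. -/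
theorem isFieldBaseChange_iff_coordinates {ι : Type*} (b : Module.Basis ι K L) (F : A' →+* A)
    (hs : ∀ t : K, F (algebraMap K A' t) = algebraMap L A (algebraMap K L t)) :
    IsFieldBaseChange K L F ↔
      Function.Bijective
        (fun x : ι →₀ A' => x.sum fun i y => algebraMap L A (b i) * F y) := by
  classical
  rw [isFieldBaseChange_iff_bijective F hs,
    ← Function.Bijective.of_comp_iff _
      (TensorProduct.equivFinsuppOfBasisLeft (N := A') b).symm.bijective]
  apply Iff.of_eq
  congr 1
  ext x
  simp [TensorProduct.equivFinsuppOfBasisLeft_symm_apply, Finsupp.sum, tensorLiftRingHom_tmul]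

/-- Taking invariants under a distribution commutes with base change along a field extension. -/
theorem IsFieldBaseChange.fixedSubalgebra {F : A' →+* A} (hF : IsFieldBaseChange K L F)
    {ℱ' : Submodule A' (Derivation K A' A')} {ℱ : Submodule A (Derivation L A A)}
    (descends : ∀ D' ∈ ℱ', ∃ D ∈ ℱ, ∀ x : A', F (D' x) = D (F x))
    (spans : ℱ ≤ Submodule.span A
      {D : Derivation L A A | ∃ D' ∈ ℱ', ∀ x : A', F (D' x) = D (F x)}) :
    ∃ F₀ : Distribution.fixedSubalgebra K ℱ' →+* Distribution.fixedSubalgebra L ℱ,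
      (∀ x : Distribution.fixedSubalgebra K ℱ', (F₀ x : A) = F (x : A')) ∧
      IsFieldBaseChange K L F₀ := by
  have hmaps : ∀ x : Distribution.fixedSubalgebra K ℱ',
      (F.comp (Distribution.fixedSubalgebra K ℱ').subtype) x ∈
        Distribution.fixedSubalgebra L ℱ := fun x =>
    Distribution.mem_fixedSubalgebra_of_le_span spans fun D ⟨D', hD', h⟩ => by
      change D (F x) = 0
      rw [← h, x.2 D' hD', map_zero]
  let F₀ : Distribution.fixedSubalgebra K ℱ' →+* Distribution.fixedSubalgebra L ℱ :=
    (F.comp (Distribution.fixedSubalgebra K ℱ').subtype).codRestrict _ hmaps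
  have hF₀ : ∀ x, (F₀ x : A) = F (x : A') := fun _ => rfl
  have hs : ∀ t : K, F₀ (algebraMap K _ t) = algebraMap L _ (algebraMap K L t) :=
    fun t => Subtype.ext (hF.semilinear t)
  refine ⟨F₀, hF₀, ?_⟩
  let b := Module.Basis.ofVectorSpace K L
  have hbij := (isFieldBaseChange_iff_coordinates b F hF.semilinear).mp hF
  rw [isFieldBaseChange_iff_coordinates b F₀ hs]
  have hcoe : ∀ x : _ →₀ Distribution.fixedSubalgebra K ℱ',
      ((x.sum fun i y => algebraMap L _ (b i) * F₀ y : Distribution.fixedSubalgebra L ℱ) : A) =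
        (x.mapRange Subtype.val rfl).sum fun i y => algebraMap L A (b i) * F y := by
    intro x
    rw [Finsupp.sum_mapRange_index (by simp), Finsupp.sum, Finsupp.sum,
      AddSubmonoidClass.coe_finsetSum]
    rfl
  constructor
  · intro x y hxy
    refine Finsupp.mapRange_injective Subtype.val rfl Subtype.val_injective (hbij.injective ?_)
    simpa only [hcoe] using congrArg Subtype.val hxy
  · rintro ⟨a, ha⟩
    obtain ⟨x, rfl⟩ := hbij.surjective a
    have hx : ∀ i, x i ∈ Distribution.fixedSubalgebra K ℱ' := by
      intro i D' hD'
      obtain ⟨D, hD, h⟩ := descends D' hD'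
      have hzero : x.mapRange D' (map_zero D') = 0 := hbij.injective <| by
        simpa [Derivation.apply_sum_coordinates b h] using ha D hD
      simpa using DFunLike.congr_fun hzero i
    refine ⟨Finsupp.onFinset x.support (fun i => ⟨x i, hx i⟩) fun i hi => ?_, ?_⟩
    · simpa [Subtype.ext_iff] using hi
    · apply Subtype.ext
      rw [hcoe]
      exact congrArg (Finsupp.sum · _) (Finsupp.ext fun i => rfl)

end BaseChange

/-- A Frobenius model is a base change along the Frobenius. -/
theorem isFrobeniusModel_iff_isFieldBaseChange (K : Type u) [Field K] (p : ℕ) [Fact p.Prime]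
    [CharP K p] {A' A : Type u} [CommRing A'] [CommRing A] [Algebra K A'] [Algebra K A]
    (F : A' →+* A) :
    IsFrobeniusModel K p A' A F ↔
      @IsFieldBaseChange K K _ _ (frobenius K p).toAlgebra A' A _ _ _ _ F :=
  ⟨fun h => @IsFieldBaseChange.mk K K _ _ (frobenius K p).toAlgebra A' A _ _ _ _ F h.1 h.2,
    fun h => ⟨@IsFieldBaseChange.semilinear K K _ _ (frobenius K p).toAlgebra A' A _ _ _ _ F h,
      @IsFieldBaseChange.isPushout K K _ _ (frobenius K p).toAlgebra A' A _ _ _ _ F h⟩⟩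

/-- If the `p`-closed foliation `ℱ` on `X` descends to `ℱ'` on the
model `X̃`, then the quotient `X̃/ℱ'` is a model of the quotient `X/ℱ` over `K^p`. -/
theorem quotient_of_model_is_model_of_quotient
    (K : Type u) [Field K] (p : ℕ) [Fact p.Prime] [CharP K p] (hFF : IsFFinite K p)
    (A' A : Type u) [CommRing A'] [CommRing A] [Algebra K A'] [Algebra K A]
    [Algebra.FiniteType K A] [Algebra.FiniteType K A']
    (F : A' →+* A) (hF : IsFrobeniusModel K p A' A F)
    (ℱ : Submodule A (Derivation K A A)) (ℱ' : Submodule A' (Derivation K A' A'))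
    (hfol : Distribution.IsFoliation K ℱ) (hpcl : Distribution.IsPClosed K p ℱ)
    (hmodel : IsDistributionModel K F ℱ' ℱ) :
    ∃ F₀ : (Distribution.fixedSubalgebra K ℱ') →+* (Distribution.fixedSubalgebra K ℱ),
      (∀ x : Distribution.fixedSubalgebra K ℱ', (F₀ x : A) = F (x : A')) ∧
      IsFrobeniusModel K p (Distribution.fixedSubalgebra K ℱ')
        (Distribution.fixedSubalgebra K ℱ) F₀ := by
  obtain ⟨F₀, hF₀, hF₀K⟩ := @IsFieldBaseChange.fixedSubalgebra K K A' A _ _ _ _ _ _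
    (frobenius K p).toAlgebra F ((isFrobeniusModel_iff_isFieldBaseChange K p F).mp hF) ℱ' ℱ
    hmodel.descends hmodel.spans
  exact ⟨F₀, hF₀, (isFrobeniusModel_iff_isFieldBaseChange K p F₀).mpr hF₀K⟩
end
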